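/- arXiv:1611.02525 — 4 statements merged into one kernel-verified Lean document; each statement's English description precedes it below -/
import Mathlib

section
/- Let β > 0 and let 0 < α₁ < β/(1+β) < α₂ ≤ 1. Then lim_{p→∞} ( Σ_{r=⌈α₁ p⌉}^{⌊α₂ p⌋} binom(p−1, r−1)²·β^{2r} ) / ( Σ_{r=1}^{p} binom(p−1, r−1)²·β^{2r} ) = 1. Equivalently, with the normalized coefficients ε_r(p,β)/z_p(β) satisfying Σ_{r=1}^{p} (ε_r/z_p)² = 1, the total squared mass of the coefficients with index r ∈ [α₁ p, α₂ p] tends to 1 as p → ∞. -/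
open Filter

/-- Summation by parts for the squared binomial weights, from
`(k + 1) * C(n, k + 1) = (n - k) * C(n, k)`. -/
theorem sum_sq_mul_choose_sq_mul_pow (β : ℝ) (n : ℕ) (f : ℕ → ℝ) :
    ∑ k ∈ Finset.range (n + 1), f k * (k : ℝ) ^ 2 * ((n.choose k : ℝ) ^ 2 * β ^ (2 * k)) =
      ∑ k ∈ Finset.range (n + 1),
        f (k + 1) * (β ^ 2 * ((n : ℝ) - k) ^ 2) * ((n.choose k : ℝ) ^ 2 * β ^ (2 * k)) := by
  rw [Finset.sum_range_succ', Finset.sum_range_succ _ n]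
  simp only [Nat.cast_zero, sub_self, ne_eq, OfNat.ofNat_ne_zero, not_false_eq_true, zero_pow,
    mul_zero, zero_mul, add_zero]
  refine Finset.sum_congr rfl fun k hk => ?_
  have hkn : k ≤ n := (Finset.mem_range.mp hk).le
  have h : (n.choose (k + 1) : ℝ) * (k + 1) = n.choose k * ((n : ℝ) - k) := by
    have := Nat.choose_succ_right_eq n k
    rw [← Nat.cast_sub hkn]
    exact_mod_cast this
  calc f (k + 1) * ((k + 1 : ℕ) : ℝ) ^ 2 * ((n.choose (k + 1) : ℝ) ^ 2 * β ^ (2 * (k + 1)))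
      = f (k + 1) * β ^ (2 * k) * β ^ 2 * ((n.choose (k + 1) : ℝ) * (k + 1)) ^ 2 := by
        push_cast; ring
    _ = _ := by rw [h]; ring

/-- A second moment bound for the squared binomial weights around `β / (1 + β) * n`. -/
theorem sum_deviation_sq_mul_choose_sq_le {β : ℝ} (hβ : 0 < β) (n : ℕ) :
    min 1 β * n * ∑ k ∈ Finset.range (n + 1),
        ((1 + β) * k - β * n) ^ 2 * ((n.choose k : ℝ) ^ 2 * β ^ (2 * k)) ≤
      (1 + β) * β ^ 2 * n ^ 2 *
        ∑ k ∈ Finset.range (n + 1), (n.choose k : ℝ) ^ 2 * β ^ (2 * k) := by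
  have key := sum_sq_mul_choose_sq_mul_pow β n fun k => (1 + β) * k - β * n
  rw [eq_comm, ← sub_eq_zero, ← Finset.sum_sub_distrib] at key
  rw [Finset.mul_sum, Finset.mul_sum, ← sub_nonneg, ← Finset.sum_sub_distrib, ← key]
  refine Finset.sum_le_sum fun k hk => ?_
  have hkn : (k : ℝ) ≤ n := by exact_mod_cast Finset.mem_range_succ_iff.mp hk
  have hk0 : (0 : ℝ) ≤ k := k.cast_nonneg
  have hs : min 1 β * n ≤ k + β * (n - k) := by
    nlinarith [min_le_left 1 β, min_le_right 1 β]
  have hd : ((n : ℝ) - k) ^ 2 ≤ n ^ 2 := by nlinarith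
  have h1 := mul_le_mul_of_nonneg_right hs (sq_nonneg ((1 + β) * k - β * n))
  have h2 := mul_le_mul_of_nonneg_left hd (by positivity : 0 ≤ (1 + β) * β ^ 2)
  have ha : 0 ≤ (n.choose k : ℝ) ^ 2 * β ^ (2 * k) := by positivity
  push_cast
  generalize (n.choose k : ℝ) ^ 2 * β ^ (2 * k) = a at ha ⊢
  have h3 := mul_le_mul_of_nonneg_right (add_le_add h1 (neg_le_neg h2)) ha
  linarith

/-- The second moment bound with both indices shifted by one. -/
theorem sum_Icc_deviation_sq_mul_choose_sq_le {β : ℝ} (hβ : 0 < β) {p : ℕ} (hp : 2 ≤ p) :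
    ∑ r ∈ Finset.Icc 1 p, ((1 + β) * r - β * p - 1) ^ 2 *
        (((p - 1).choose (r - 1) : ℝ) ^ 2 * β ^ (2 * r)) ≤
      (1 + β) * β ^ 2 / min 1 β * p *
        ∑ r ∈ Finset.Icc 1 p, ((p - 1).choose (r - 1) : ℝ) ^ 2 * β ^ (2 * r) := by
  obtain ⟨n, rfl⟩ : ∃ n, p = n + 1 := ⟨p - 1, by omega⟩
  have shift (f : ℕ → ℝ) :
      ∑ r ∈ Finset.Icc 1 (n + 1), f r = ∑ k ∈ Finset.range (n + 1), f (k + 1) := by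
    rw [Finset.range_eq_Ico, Finset.sum_Ico_add']
    rfl
  rw [shift, shift]
  have hm : 0 < min 1 β := lt_min one_pos hβ
  have hn : (0 : ℝ) < n := by exact_mod_cast (by omega : 0 < n)
  have h := sum_deviation_sq_mul_choose_sq_le hβ n
  have e1 : ∑ k ∈ Finset.range (n + 1), ((1 + β) * ((k + 1 : ℕ) : ℝ) - β * ((n + 1 : ℕ) : ℝ) - 1) ^ 2
        * (((n + 1 - 1).choose (k + 1 - 1) : ℝ) ^ 2 * β ^ (2 * (k + 1))) =
      β ^ 2 * ∑ k ∈ Finset.range (n + 1),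
        ((1 + β) * k - β * n) ^ 2 * ((n.choose k : ℝ) ^ 2 * β ^ (2 * k)) := by
    rw [Finset.mul_sum]
    refine Finset.sum_congr rfl fun k _ => ?_
    simp only [Nat.add_sub_cancel]
    push_cast
    ring
  have e2 : ∑ k ∈ Finset.range (n + 1),
        ((n + 1 - 1).choose (k + 1 - 1) : ℝ) ^ 2 * β ^ (2 * (k + 1)) =
      β ^ 2 * ∑ k ∈ Finset.range (n + 1), (n.choose k : ℝ) ^ 2 * β ^ (2 * k) := by
    rw [Finset.mul_sum]
    refine Finset.sum_congr rfl fun k _ => ?_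
    simp only [Nat.add_sub_cancel]
    ring
  rw [e1, e2]
  have hT : 0 ≤ ∑ k ∈ Finset.range (n + 1), (n.choose k : ℝ) ^ 2 * β ^ (2 * k) :=
    Finset.sum_nonneg fun k _ => by positivity
  generalize ∑ k ∈ Finset.range (n + 1), (n.choose k : ℝ) ^ 2 * β ^ (2 * k) = T at *
  generalize ∑ k ∈ Finset.range (n + 1),
        ((1 + β) * k - β * n) ^ 2 * ((n.choose k : ℝ) ^ 2 * β ^ (2 * k)) = S at *
  have hS : S ≤ (1 + β) * β ^ 2 / min 1 β * n * T := by
    rw [← mul_le_mul_iff_right₀ (mul_pos hm hn)]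
    refine h.trans_eq ?_
    field_simp
  calc β ^ 2 * S ≤ β ^ 2 * ((1 + β) * β ^ 2 / min 1 β * n * T) := by gcongr
    _ ≤ β ^ 2 * ((1 + β) * β ^ 2 / min 1 β * ((n + 1 : ℕ) : ℝ) * T) := by
        gcongr
        exact n.le_succ
    _ = _ := by ring

/-- The squared coefficient mass of the indices `r ∈ [α₁ p, α₂ p]` tends to 1:
for `β > 0` and `0 < α₁ < β/(1+β) < α₂ ≤ 1`,
`(Σ_{r=⌈α₁p⌉}^{⌊α₂p⌋} C(p-1,r-1)²·β^{2r}) / (Σ_{r=1}^{p} C(p-1,r-1)²·β^{2r}) → 1`. -/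
theorem squared_mass_concentration (β : ℝ) (hβ : 0 < β) (α₁ α₂ : ℝ)
    (h1 : 0 < α₁) (h2 : α₁ < β / (1 + β)) (h3 : β / (1 + β) < α₂) (h4 : α₂ ≤ 1) :
    Tendsto
      (fun p : ℕ =>
        (∑ r ∈ Finset.Icc ⌈α₁ * p⌉₊ ⌊α₂ * p⌋₊,
            ((p - 1).choose (r - 1) : ℝ) ^ 2 * β ^ (2 * r)) /
        (∑ r ∈ Finset.Icc 1 p, ((p - 1).choose (r - 1) : ℝ) ^ 2 * β ^ (2 * r)))
      atTop (nhds 1) := by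
  have hβ1 : 0 < 1 + β := by linarith
  rw [lt_div_iff₀ hβ1] at h2
  rw [div_lt_iff₀ hβ1] at h3
  obtain ⟨δ, hδ, hδ1, hδ2⟩ : ∃ δ : ℝ, 0 < δ ∧ δ ≤ β - α₁ * (1 + β) ∧
      2 * δ ≤ α₂ * (1 + β) - β := by
    refine ⟨min (β - α₁ * (1 + β)) ((α₂ * (1 + β) - β) / 2),
      lt_min (by linarith) (by linarith), min_le_left _ _, ?_⟩
    linarith [min_le_right (β - α₁ * (1 + β)) ((α₂ * (1 + β) - β) / 2)]
  set K := (1 + β) * β ^ 2 / min 1 β with hK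
  have hlim : Tendsto (fun p : ℕ => 1 - K / δ ^ 2 / (p : ℝ)) atTop (nhds 1) := by
    simpa using (tendsto_const_div_atTop_nhds_zero_nat (K / δ ^ 2)).const_sub 1
  have hsub (p : ℕ) (hp : 2 ≤ p) : Finset.Icc ⌈α₁ * p⌉₊ ⌊α₂ * p⌋₊ ⊆ Finset.Icc 1 p := by
    have hp0 : (0 : ℝ) < p := by exact_mod_cast (by omega : 0 < p)
    refine Finset.Icc_subset_Icc (Nat.one_le_ceil_iff.mpr (by positivity)) ?_
    exact Nat.floor_le_of_le (by nlinarith)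
  refine tendsto_of_tendsto_of_tendsto_of_le_of_le' hlim tendsto_const_nhds ?_ ?_
  · filter_upwards [eventually_ge_atTop 2, eventually_ge_atTop ⌈1 / δ⌉₊] with p hp hpδ
    have hp0 : (0 : ℝ) < p := by exact_mod_cast (by omega : 0 < p)
    have hpδ' : 1 ≤ p * δ := (div_le_iff₀ hδ).mp (Nat.ceil_le.mp hpδ)
    have hmom := sum_Icc_deviation_sq_mul_choose_sq_le hβ hp
    have hsplit := Finset.sum_sdiff
      (f := fun r => ((p - 1).choose (r - 1) : ℝ) ^ 2 * β ^ (2 * r)) (hsub p hp)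
    have hT : 0 < ∑ r ∈ Finset.Icc 1 p, ((p - 1).choose (r - 1) : ℝ) ^ 2 * β ^ (2 * r) := by
      refine Finset.sum_pos (fun r hr => ?_) ⟨1, by simp; omega⟩
      have hr' := Finset.mem_Icc.mp hr
      have := Nat.choose_pos (by omega : r - 1 ≤ p - 1)
      positivity
    have htail : (δ * p) ^ 2 * ∑ r ∈ Finset.Icc 1 p \ Finset.Icc ⌈α₁ * p⌉₊ ⌊α₂ * p⌋₊,
          ((p - 1).choose (r - 1) : ℝ) ^ 2 * β ^ (2 * r) ≤
        ∑ r ∈ Finset.Icc 1 p, ((1 + β) * r - β * p - 1) ^ 2 *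
          (((p - 1).choose (r - 1) : ℝ) ^ 2 * β ^ (2 * r)) := by
      rw [Finset.mul_sum]
      refine (Finset.sum_le_sum fun r hr => ?_).trans
        (Finset.sum_le_sum_of_subset_of_nonneg Finset.sdiff_subset fun r _ _ => by positivity)
      refine mul_le_mul_of_nonneg_right ?_ (by positivity)
      rw [Finset.mem_sdiff, Finset.mem_Icc (a := ⌈α₁ * p⌉₊), not_and_or, not_le, not_le,
        Nat.lt_ceil, Nat.floor_lt' (by have := Finset.mem_Icc.mp hr.1; omega)] at hr
      have hδp : 0 ≤ δ * p := by positivity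
      rw [sq_le_sq, abs_of_nonneg hδp, le_abs]
      rcases hr.2 with h | h
      · right
        nlinarith
      · left
        nlinarith
    rw [← hK] at hmom
    rw [le_div_iff₀ hT]
    have hb := htail.trans hmom
    generalize ∑ r ∈ Finset.Icc 1 p, ((p - 1).choose (r - 1) : ℝ) ^ 2 * β ^ (2 * r) = T at *
    rw [← eq_sub_iff_add_eq] at hsplit
    rw [hsplit, ← le_div_iff₀' (by positivity)] at hb
    have : K * p * T / (δ * p) ^ 2 = K / δ ^ 2 / p * T := by field_simp
    linarith
  · filter_upwards [eventually_ge_atTop 2] with p hp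
    exact div_le_one_of_le₀ (Finset.sum_le_sum_of_subset_of_nonneg (hsub p hp)
      fun r _ _ => by positivity) (Finset.sum_nonneg fun r _ => by positivity)
end

section
/- Let p ≥ 1 be an integer. For every integer 1 ≤ k ≤ p there exists β > 0 such that k is a maximizer over r ∈ {1, …, p} of the map r ↦ binom(p, r)·β^r. -/
theorem succ_mul_choose_succ_mul_pow (p r : ℕ) (β : ℝ) :
    ((r : ℝ) + 1) * ((p.choose (r + 1) : ℝ) * β ^ (r + 1)) =
      ((p - r : ℕ) : ℝ) * β * ((p.choose r : ℝ) * β ^ r) := by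
  have h : (p.choose (r + 1) : ℝ) * ((r : ℝ) + 1) = p.choose r * ((p - r : ℕ) : ℝ) := by
    exact_mod_cast Nat.choose_succ_right_eq p r
  rw [pow_succ]
  linear_combination β ^ r * β * h

theorem choose_mul_pow_le_succ {p r : ℕ} {β : ℝ} (hβ : 0 ≤ β)
    (h : (r : ℝ) + 1 ≤ ((p - r : ℕ) : ℝ) * β) :
    (p.choose r : ℝ) * β ^ r ≤ (p.choose (r + 1) : ℝ) * β ^ (r + 1) := by
  refine le_of_mul_le_mul_left ?_ (by positivity : (0 : ℝ) < r + 1)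
  rw [succ_mul_choose_succ_mul_pow]
  gcongr

theorem choose_succ_mul_pow_le {p r : ℕ} {β : ℝ} (hβ : 0 ≤ β)
    (h : ((p - r : ℕ) : ℝ) * β ≤ (r : ℝ) + 1) :
    (p.choose (r + 1) : ℝ) * β ^ (r + 1) ≤ (p.choose r : ℝ) * β ^ r := by
  refine le_of_mul_le_mul_left ?_ (by positivity : (0 : ℝ) < r + 1)
  rw [succ_mul_choose_succ_mul_pow]
  gcongr

/-- For a depth-`p` residual network, the dominant path length can be shifted to
any value: for every `1 ≤ k ≤ p` there is `β > 0` such that `k` maximizes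
`r ↦ C(p, r)·β^r` over `r ∈ {1,…,p}`. -/
theorem exists_scale_shifting_argmax (p : ℕ) (hp : 1 ≤ p) (k : ℕ)
    (hk : k ∈ Finset.Icc 1 p) :
    ∃ β : ℝ, 0 < β ∧
      ∀ r ∈ Finset.Icc 1 p,
        (p.choose r : ℝ) * β ^ r ≤ (p.choose k : ℝ) * β ^ k := by
  obtain ⟨hk1, hkp⟩ := Finset.mem_Icc.mp hk
  have hk0 : (0 : ℝ) < k := by exact_mod_cast hk1
  have hd : (0 : ℝ) < ((p + 1 - k : ℕ) : ℝ) := by exact_mod_cast (by omega : 0 < p + 1 - k)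
  have hβ : (0 : ℝ) < k / ((p + 1 - k : ℕ) : ℝ) := div_pos hk0 hd
  refine ⟨k / ((p + 1 - k : ℕ) : ℝ), hβ, ?_⟩
  rintro r -
  rcases le_total r k with hrk | hkr
  · induction hrk using Nat.decreasingInduction with
    | self => exact le_rfl
    | of_succ r hr ih =>
      refine (choose_mul_pow_le_succ hβ.le ?_).trans ih
      rw [← mul_div_assoc, le_div_iff₀ hd, mul_comm ((p - r : ℕ) : ℝ)]
      exact_mod_cast Nat.mul_le_mul (by omega : r + 1 ≤ k) (by omega : p + 1 - k ≤ p - r)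
  · induction r, hkr using Nat.le_induction with
    | base => exact le_rfl
    | succ r hr ih =>
      refine (choose_succ_mul_pow_le hβ.le ?_).trans ih
      rw [← mul_div_assoc, div_le_iff₀ hd, mul_comm ((p - r : ℕ) : ℝ)]
      exact_mod_cast Nat.mul_le_mul (by omega : k ≤ r + 1) (by omega : p - r ≤ p + 1 - k)
end

section
/- Let p ≥ 2 be an integer. For ε = (ε_2, …, ε_p) ∈ ℝ^{p−1} with Σ_{r=2}^{p} ε_r² = 1, define v'(ε) = Σ_{r=2}^{p} ε_r²·r, v''(ε) = Σ_{r=2}^{p} ε_r²·r(r−1), and θ(ε) = (1/2)·log(v''(ε)/v'(ε)) − (v''(ε) − v'(ε))/(v''(ε) + v'(ε)). Then for all such ε, θ(ε) ≤ (1/2)·log(p−1) − (1 − 2/p), and equality holds for ε* with ε*_p = 1 and ε*_r = 0 for r < p. -/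
/-- `v'(ε) = Σ_{r=2}^p ε_r²·r`. -/
noncomputable def vPrime (p : ℕ) (ε : ℕ → ℝ) : ℝ :=
  ∑ r ∈ Finset.Icc 2 p, (ε r) ^ 2 * (r : ℝ)

/-- `v''(ε) = Σ_{r=2}^p ε_r²·r·(r-1)`. -/
noncomputable def vPrimePrime (p : ℕ) (ε : ℕ → ℝ) : ℝ :=
  ∑ r ∈ Finset.Icc 2 p, (ε r) ^ 2 * (r : ℝ) * ((r : ℝ) - 1)

/-- The exponential growth rate of the expected number of finite-index critical points
of the mixed spherical spin glass with mixture `ε`. -/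
noncomputable def theta (p : ℕ) (ε : ℕ → ℝ) : ℝ :=
  (1 / 2) * Real.log (vPrimePrime p ε / vPrime p ε) -
    (vPrimePrime p ε - vPrime p ε) / (vPrimePrime p ε + vPrime p ε)

/-- The function `x ↦ (1/2) log x - (x-1)/(x+1)` is monotone on `[1, ∞)`. -/
theorem half_log_sub_div_le {x y : ℝ} (hx : 1 ≤ x) (hxy : x ≤ y) :
    (1 / 2) * Real.log x - (x - 1) / (x + 1) ≤ (1 / 2) * Real.log y - (y - 1) / (y + 1) := by
  have hx0 : 0 < x := by linarith
  have hy0 : 0 < y := by linarith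
  have hlog : 2 * ((y - x) / (y + x)) ≤ Real.log y - Real.log x := by
    have h := Real.le_log_one_add_of_nonneg (x := (y - x) / x)
      (div_nonneg (by linarith) hx0.le)
    have h1 : 1 + (y - x) / x = y / x := by field_simp; ring
    have h2 : 2 * ((y - x) / x) / ((y - x) / x + 2) = 2 * ((y - x) / (y + x)) := by
      have h3 : (y - x) / x + 2 = (y + x) / x := by field_simp; ring
      rw [h3]
      field_simp
    rwa [h1, h2, Real.log_div hy0.ne' hx0.ne'] at h
  have hfrac : (y - 1) / (y + 1) - (x - 1) / (x + 1) ≤ (y - x) / (y + x) := by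
    have h1 : (y - 1) / (y + 1) - (x - 1) / (x + 1) =
        (y - x) * 2 / ((y + 1) * (x + 1)) := by
      field_simp
      ring
    rw [h1, div_le_div_iff₀ (by positivity) (by positivity), mul_assoc]
    refine mul_le_mul_of_nonneg_left ?_ (by linarith)
    nlinarith [mul_nonneg (sub_nonneg.2 hx) (sub_nonneg.2 (hx.trans hxy))]
  linarith

theorem two_le_vPrime {p : ℕ} {ε : ℕ → ℝ} (h : ∑ r ∈ Finset.Icc 2 p, (ε r) ^ 2 = 1) :
    2 ≤ vPrime p ε := by
  calc (2 : ℝ) = ∑ r ∈ Finset.Icc 2 p, (ε r) ^ 2 * 2 := by rw [← Finset.sum_mul, h, one_mul]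
    _ ≤ vPrime p ε := Finset.sum_le_sum fun r hr => by
      have : (2 : ℝ) ≤ r := by exact_mod_cast (Finset.mem_Icc.1 hr).1
      gcongr

theorem vPrime_le_vPrimePrime (p : ℕ) (ε : ℕ → ℝ) : vPrime p ε ≤ vPrimePrime p ε :=
  Finset.sum_le_sum fun r hr => by
    have : (2 : ℝ) ≤ r := by exact_mod_cast (Finset.mem_Icc.1 hr).1
    exact le_mul_of_one_le_right (by positivity) (by linarith)

theorem vPrimePrime_le (p : ℕ) (ε : ℕ → ℝ) :
    vPrimePrime p ε ≤ ((p : ℝ) - 1) * vPrime p ε := by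
  rw [mul_comm, vPrime, Finset.sum_mul]
  refine Finset.sum_le_sum fun r hr => ?_
  have : (r : ℝ) ≤ p := by exact_mod_cast (Finset.mem_Icc.1 hr).2
  gcongr

theorem theta_eq_of_vPrime_pos {p : ℕ} {ε : ℕ → ℝ} (h : 0 < vPrime p ε) :
    theta p ε = (1 / 2) * Real.log (vPrimePrime p ε / vPrime p ε) -
      (vPrimePrime p ε / vPrime p ε - 1) / (vPrimePrime p ε / vPrime p ε + 1) := by
  rw [theta, div_sub_one h.ne', div_add_one h.ne', div_div_div_cancel_right₀ h.ne']

/-- Among all mixtures `ε` with `Σ_{r=2}^p ε_r² = 1`, the pure `p`-interaction model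
maximizes `θ`, with maximal value `(1/2)·log(p-1) − (1 − 2/p)`. -/
theorem pure_interaction_maximizes_theta (p : ℕ) (hp : 2 ≤ p) :
    (∀ ε : ℕ → ℝ, (∑ r ∈ Finset.Icc 2 p, (ε r) ^ 2) = 1 →
      theta p ε ≤ (1 / 2) * Real.log ((p : ℝ) - 1) - (1 - 2 / (p : ℝ))) ∧
    theta p (fun r => if r = p then 1 else 0) =
      (1 / 2) * Real.log ((p : ℝ) - 1) - (1 - 2 / (p : ℝ)) := by
  have hp0 : (0 : ℝ) < p := by exact_mod_cast (by omega : 0 < p)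
  have hval : 1 - 2 / (p : ℝ) = ((p : ℝ) - 1 - 1) / ((p : ℝ) - 1 + 1) := by
    rw [sub_add_cancel]
    field_simp
    ring
  rw [hval]
  constructor
  · intro ε hε
    have hv : 0 < vPrime p ε := by linarith [two_le_vPrime hε]
    rw [theta_eq_of_vPrime_pos hv]
    exact half_log_sub_div_le ((one_le_div hv).2 (vPrime_le_vPrimePrime p ε))
      ((div_le_iff₀ hv).2 (vPrimePrime_le p ε))
  · have h1 : vPrime p (fun r => if r = p then 1 else 0) = p := by
      simp [vPrime, hp]
    have h2 : vPrimePrime p (fun r => if r = p then 1 else 0) = p * ((p : ℝ) - 1) := by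
      simp [vPrimePrime, hp]
    rw [theta_eq_of_vPrime_pos (by rwa [h1]), h1, h2, mul_div_cancel_left₀ _ hp0.ne']
end

section
/- Let x > 0. Then lim_{p→∞} (1/p)·log( Σ_{r=0}^{p} binom(p, r)²·x^r ) = 2·log(1 + √x). In particular, for β > 0, the normalization z_p(β)² = Σ_{s=1}^{p} binom(p−1, s−1)²·β^{2s} satisfies lim_{p→∞} (1/p)·log z_p(β)² = 2·log(1+β). -/
open Filter

theorem one_add_pow_sq_le_sum_sq_choose (b : ℝ) (p : ℕ) :
    ((1 + b) ^ p) ^ 2 ≤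
      (p + 1) * ∑ r ∈ Finset.range (p + 1), (p.choose r : ℝ) ^ 2 * (b ^ 2) ^ r := by
  have h := sq_sum_le_card_mul_sum_sq (s := Finset.range (p + 1))
    (f := fun r => b ^ r * (p.choose r : ℝ))
  rw [add_comm 1 b, add_pow]
  simpa [mul_pow, mul_comm, ← pow_mul] using h

theorem sum_sq_choose_le_one_add_pow_sq {b : ℝ} (hb : 0 ≤ b) (p : ℕ) :
    ∑ r ∈ Finset.range (p + 1), (p.choose r : ℝ) ^ 2 * (b ^ 2) ^ r ≤ ((1 + b) ^ p) ^ 2 := by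
  have h := Finset.sum_sq_le_sq_sum_of_nonneg (s := Finset.range (p + 1))
    (f := fun r => b ^ r * (p.choose r : ℝ)) (fun r _ => by positivity)
  rw [add_comm 1 b, add_pow]
  simpa [mul_pow, mul_comm, ← pow_mul] using h

theorem sum_sq_choose_pos {b : ℝ} (hb : 0 < b) (p : ℕ) :
    0 < ∑ r ∈ Finset.range (p + 1), (p.choose r : ℝ) ^ 2 * (b ^ 2) ^ r := by
  have h := one_add_pow_sq_le_sum_sq_choose b p
  have h1 : 0 < ((1 + b) ^ p) ^ 2 := by positivity
  exact pos_of_mul_pos_right (h1.trans_le h) (by positivity)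

theorem tendsto_log_sum_sq_choose {b : ℝ} (hb : 0 < b) :
    Tendsto
      (fun p : ℕ => (1 / (p : ℝ)) *
        Real.log (∑ r ∈ Finset.range (p + 1), (p.choose r : ℝ) ^ 2 * (b ^ 2) ^ r))
      atTop (nhds (2 * Real.log (1 + b))) := by
  have hlog : Tendsto (fun p : ℕ => Real.log (p + 1) / (p : ℝ)) atTop (nhds 0) := by
    have h := (Real.tendsto_pow_log_div_mul_add_atTop 1 (-1) 1 one_ne_zero).comp
      (tendsto_atTop_add_const_right atTop (1 : ℝ) tendsto_natCast_atTop_atTop)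
    simpa [Function.comp_def] using h
  have hlower : Tendsto (fun p : ℕ => 2 * Real.log (1 + b) - Real.log (p + 1) / (p : ℝ))
      atTop (nhds (2 * Real.log (1 + b))) := by
    simpa using hlog.const_sub (2 * Real.log (1 + b))
  refine tendsto_of_tendsto_of_tendsto_of_le_of_le' hlower tendsto_const_nhds ?_ ?_
  · filter_upwards [eventually_gt_atTop 0] with p hp
    have hp' : (0 : ℝ) < p := by exact_mod_cast hp
    have h := Real.log_le_log (by positivity) (one_add_pow_sq_le_sum_sq_choose b p)
    rw [Real.log_mul (by positivity) (sum_sq_choose_pos hb p).ne', Real.log_pow,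
      Real.log_pow] at h
    rw [one_div_mul_eq_div, le_div_iff₀ hp', sub_mul, div_mul_cancel₀ _ hp'.ne']
    push_cast at h
    linarith
  · filter_upwards [eventually_gt_atTop 0] with p hp
    have hp' : (0 : ℝ) < p := by exact_mod_cast hp
    have h := Real.log_le_log (sum_sq_choose_pos hb p) (sum_sq_choose_le_one_add_pow_sq hb.le p)
    rw [Real.log_pow, Real.log_pow] at h
    rw [one_div_mul_eq_div, div_le_iff₀ hp']
    push_cast at h
    linarith

theorem sum_Icc_sq_choose_eq (b : ℝ) (q : ℕ) :
    ∑ s ∈ Finset.Icc 1 (q + 1), ((q + 1 - 1).choose (s - 1) : ℝ) ^ 2 * b ^ (2 * s) =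
      b ^ 2 * ∑ r ∈ Finset.range (q + 1), (q.choose r : ℝ) ^ 2 * (b ^ 2) ^ r := by
  rw [← Finset.Ico_add_one_right_eq_Icc, Finset.sum_Ico_eq_sum_range, Finset.mul_sum]
  refine Finset.sum_congr rfl fun r _ => ?_
  simp only [Nat.add_sub_cancel, Nat.add_sub_cancel_left]
  ring

/-- Exponential rate of the sum of squared binomials:
`(1/p)·log(Σ_{r=0}^p C(p,r)²·x^r) → 2·log(1+√x)`; in particular the
normalization `z_p(β)² = Σ_{s=1}^p C(p-1,s-1)²·β^{2s}` satisfies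
`(1/p)·log z_p(β)² → 2·log(1+β)`. -/
theorem sum_sq_choose_exponential_rate (x : ℝ) (hx : 0 < x) :
    Tendsto
      (fun p : ℕ => (1 / (p : ℝ)) *
        Real.log (∑ r ∈ Finset.range (p + 1), (p.choose r : ℝ) ^ 2 * x ^ r))
      atTop (nhds (2 * Real.log (1 + Real.sqrt x))) ∧
    (∀ β : ℝ, 0 < β →
      Tendsto
        (fun p : ℕ => (1 / (p : ℝ)) *
          Real.log (∑ s ∈ Finset.Icc 1 p,
            ((p - 1).choose (s - 1) : ℝ) ^ 2 * β ^ (2 * s)))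
        atTop (nhds (2 * Real.log (1 + β)))) := by
  refine ⟨?_, fun β hβ => ?_⟩
  · simpa only [Real.sq_sqrt hx.le] using tendsto_log_sum_sq_choose (Real.sqrt_pos.2 hx)
  · rw [← tendsto_add_atTop_iff_nat 1]
    have h := (tendsto_one_div_add_atTop_nhds_zero_nat (𝕜 := ℝ)).mul_const (Real.log (β ^ 2))
      |>.add ((tendsto_natCast_div_add_atTop (1 : ℝ)).mul (tendsto_log_sum_sq_choose hβ))
    rw [zero_mul, zero_add, one_mul] at h
    refine h.congr fun q => ?_
    rw [sum_Icc_sq_choose_eq, Real.log_mul (by positivity) (sum_sq_choose_pos hβ q).ne']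
    rcases Nat.eq_zero_or_pos q with rfl | hq
    · simp
    · push_cast
      field_simp
end
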